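/- For all λ, μ ∈ ℕ^t with (λ, μ) ≠ (0, 0), the element x^λ y^μ + x^μ y^λ of A is an A_+-linear combination of the elements x^γ + y^γ with γ ∈ {0,1}^t, γ ≠ 0 (i.e. it lies in the ideal of the fixed subring A_+ generated by these 2^t − 1 elements). (Intermediate claim in the proof of Lemma 2.7, using the identity (x^λ + y^λ)(x^μ + y^μ) = x^{λ+μ} + y^{λ+μ} + x^λ y^μ + x^μ y^λ.) -/

import Mathlib

noncomputable section

open MvPolynomial

/-- The defining ideal: generated by `x_i y_i + x_i + y_i`, `i = 1,…,t`. -/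
def torusRel (R : Type*) [CommRing R] (t : ℕ) : Ideal (MvPolynomial (Fin t ⊕ Fin t) R) :=
  Ideal.span { p | ∃ i : Fin t,
    p = X (Sum.inl i) * X (Sum.inr i) + X (Sum.inl i) + X (Sum.inr i) }

/-- `A = R[x_1,…,x_t,y_1,…,y_t]/(x_i y_i + x_i + y_i)`. -/
abbrev QA (R : Type*) [CommRing R] (t : ℕ) :=
  MvPolynomial (Fin t ⊕ Fin t) R ⧸ torusRel R t

/-- The image of the variable `x_i` in `A`. -/
def xg (R : Type*) [CommRing R] (t : ℕ) (i : Fin t) : QA R t :=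
  Ideal.Quotient.mk _ (X (Sum.inl i))

/-- The image of the variable `y_i` in `A`. -/
def yg (R : Type*) [CommRing R] (t : ℕ) (i : Fin t) : QA R t :=
  Ideal.Quotient.mk _ (X (Sum.inr i))

/-- `L = R[ℤ^t]`, the group algebra of `ℤ^t` over `R`. -/
abbrev LA (R : Type*) [CommRing R] (t : ℕ) := AddMonoidAlgebra R (Fin t → ℤ)

/-- The basis element `u^ν` of `L = R[ℤ^t]`. -/
def uL (R : Type*) [CommRing R] (t : ℕ) (ν : Fin t → ℤ) : LA R t :=
  AddMonoidAlgebra.single ν 1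

/-- `x^λ = ∏_i x_i^{λ_i}` in `A`. -/
def xpow (R : Type*) [CommRing R] (t : ℕ) (lam : Fin t → ℕ) : QA R t :=
  ∏ i : Fin t, xg R t i ^ lam i

/-- `y^λ = ∏_i y_i^{λ_i}` in `A`. -/
def ypow (R : Type*) [CommRing R] (t : ℕ) (lam : Fin t → ℕ) : QA R t :=
  ∏ i : Fin t, yg R t i ^ lam i

/-- The monomial `x^λ y^μ = ∏_i x_i^{λ_i} y_i^{μ_i}` in `A`. -/
def monXY (R : Type*) [CommRing R] (t : ℕ) (lam mu : Fin t → ℕ) : QA R t :=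
  ∏ i : Fin t, xg R t i ^ lam i * yg R t i ^ mu i

/-- The subalgebra `A_+` of elements fixed by `τ`. -/
def fixedSubalgebra {R A : Type*} [CommRing R] [CommRing A] [Algebra R A] (τ : A ≃ₐ[R] A) :
    Subalgebra R A :=
  AlgHom.equalizer (τ : A →ₐ[R] A) (AlgHom.id R A)

/-- The `A_+`-submodule of `A` spanned by the `x^γ + y^γ` with `γ ∈ {0,1}^t`, `γ ≠ 0`. -/
def squarefreeSpan {R : Type*} [CommRing R] {t : ℕ} (τ : QA R t ≃ₐ[R] QA R t) :
    Submodule (fixedSubalgebra τ) (QA R t) :=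
  Submodule.span _ ((fun γ : Fin t → Fin 2 =>
      xpow R t (fun i => (γ i : ℕ)) + ypow R t (fun i => (γ i : ℕ))) ''
    (Finset.univ.filter (fun γ : Fin t → Fin 2 => γ ≠ 0) : Finset (Fin t → Fin 2)))

section

variable {R : Type*} [CommRing R] {t : ℕ}

lemma xg_mul_yg (i : Fin t) : xg R t i * yg R t i = -(xg R t i + yg R t i) := by
  have h : (Ideal.Quotient.mk (torusRel R t))
      (X (Sum.inl i) * X (Sum.inr i) + X (Sum.inl i) + X (Sum.inr i)) = 0 :=
    Ideal.Quotient.eq_zero_iff_mem.mpr (Ideal.subset_span ⟨i, rfl⟩)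
  simp only [map_add, map_mul] at h
  unfold xg yg
  linear_combination h

lemma monXY_add (a b c d : Fin t → ℕ) :
    monXY R t (a + b) (c + d) = monXY R t a c * monXY R t b d := by
  simp only [monXY, ← Finset.prod_mul_distrib, Pi.add_apply, pow_add]
  exact Finset.prod_congr rfl fun i _ => by ring

lemma monXY_zero_right (a : Fin t → ℕ) : monXY R t a 0 = xpow R t a := by
  simp [monXY, xpow]

lemma monXY_zero_left (a : Fin t → ℕ) : monXY R t 0 a = ypow R t a := by
  simp [monXY, ypow]

lemma monXY_eq_mul (a b : Fin t → ℕ) : monXY R t a b = xpow R t a * ypow R t b := by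
  simp [monXY, xpow, ypow, Finset.prod_mul_distrib]

lemma xpow_single (i : Fin t) (n : ℕ) : xpow R t (Pi.single i n) = xg R t i ^ n := by
  rw [xpow, Finset.prod_eq_single i] <;> simp +contextual

lemma ypow_single (i : Fin t) (n : ℕ) : ypow R t (Pi.single i n) = yg R t i ^ n := by
  rw [ypow, Finset.prod_eq_single i] <;> simp +contextual

lemma xpow_add (a b : Fin t → ℕ) : xpow R t (a + b) = xpow R t a * xpow R t b := by
  simp [xpow, pow_add, Finset.prod_mul_distrib]

lemma ypow_add (a b : Fin t → ℕ) : ypow R t (a + b) = ypow R t a * ypow R t b := by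
  simp [ypow, pow_add, Finset.prod_mul_distrib]

variable {τ : QA R t ≃ₐ[R] QA R t}

lemma xpow_add_ypow_mem_squarefreeSpan {a : Fin t → ℕ} (ha : ∀ i, a i < 2) (h0 : a ≠ 0) :
    xpow R t a + ypow R t a ∈ squarefreeSpan τ := by
  refine Submodule.subset_span ⟨fun i => ⟨a i, ha i⟩, ?_, rfl⟩
  simp only [Finset.coe_filter, Finset.mem_univ, true_and, Set.mem_ofPred_eq]
  exact fun h => h0 (funext fun i => congrArg Fin.val (congrFun h i))

lemma xg_add_yg_mem_squarefreeSpan (i : Fin t) : xg R t i + yg R t i ∈ squarefreeSpan τ := by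
  have h := xpow_add_ypow_mem_squarefreeSpan (R := R) (τ := τ) (a := Pi.single i 1)
    (fun j => by by_cases h : j = i <;> simp [h]) (by simp)
  simpa only [xpow_single, ypow_single, pow_one] using h

lemma mul_mem_squarefreeSpan {a z : QA R t} (ha : τ a = a) (hz : z ∈ squarefreeSpan τ) :
    a * z ∈ squarefreeSpan τ :=
  (squarefreeSpan τ).smul_mem (⟨a, ha⟩ : fixedSubalgebra τ) hz

lemma map_monXY (hτx : ∀ i : Fin t, τ (xg R t i) = yg R t i)
    (hτy : ∀ i : Fin t, τ (yg R t i) = xg R t i) (a b : Fin t → ℕ) :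
    τ (monXY R t a b) = monXY R t b a := by
  simp only [monXY, map_prod, map_mul, map_pow, hτx, hτy]
  exact Finset.prod_congr rfl fun i _ => mul_comm _ _

lemma exists_eq_add_single {ι : Type*} [DecidableEq ι] {a : ι → ℕ} {i : ι} {n : ℕ}
    (h : n ≤ a i) : ∃ b : ι → ℕ, a = b + Pi.single i n := by
  refine ⟨a - Pi.single i n, (tsub_add_cancel_of_le fun j => ?_).symm⟩
  obtain rfl | hj := eq_or_ne j i <;> simp [*]

lemma monXY_symm_mem_of_both_pos (hτx : ∀ i : Fin t, τ (xg R t i) = yg R t i)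
    (hτy : ∀ i : Fin t, τ (yg R t i) = xg R t i) {a b : Fin t → ℕ} {i : Fin t}
    (ha : 1 ≤ a i) (hb : 1 ≤ b i) :
    monXY R t a b + monXY R t b a ∈ squarefreeSpan τ := by
  obtain ⟨a, rfl⟩ := exists_eq_add_single ha
  obtain ⟨b, rfl⟩ := exists_eq_add_single hb
  have hfix : τ (-(monXY R t a b + monXY R t b a)) = -(monXY R t a b + monXY R t b a) := by
    simp only [map_neg, map_add, map_monXY hτx hτy, add_comm]
  convert mul_mem_squarefreeSpan hfix (xg_add_yg_mem_squarefreeSpan i) using 1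
  simp only [monXY_add, monXY_eq_mul (Pi.single i 1), xpow_single, ypow_single, pow_one]
  linear_combination (monXY R t a b + monXY R t b a) * xg_mul_yg (R := R) i

lemma monXY_symm_mem_of_two_le (hτx : ∀ i : Fin t, τ (xg R t i) = yg R t i)
    (hτy : ∀ i : Fin t, τ (yg R t i) = xg R t i) {a : Fin t → ℕ} (b : Fin t → ℕ) {i : Fin t}
    (ha : 2 ≤ a i) :
    monXY R t a b + monXY R t b a ∈ squarefreeSpan τ := by
  obtain ⟨a, rfl⟩ := exists_eq_add_single ha
  have hfix : τ (monXY R t a b * xg R t i + monXY R t b a * yg R t i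
        + (monXY R t a b + monXY R t b a)) =
      monXY R t a b * xg R t i + monXY R t b a * yg R t i
        + (monXY R t a b + monXY R t b a) := by
    simp only [map_add, map_mul, map_monXY hτx hτy, hτx, hτy]
    ring
  convert mul_mem_squarefreeSpan hfix (xg_add_yg_mem_squarefreeSpan i) using 1
  simp only [monXY_eq_mul, xpow_add, ypow_add, xpow_single, ypow_single]
  linear_combination
    -(xpow R t a * ypow R t b + xpow R t b * ypow R t a) * xg_mul_yg (R := R) i

lemma monXY_symm_mem_of_squarefree (hτx : ∀ i : Fin t, τ (xg R t i) = yg R t i)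
    (hτy : ∀ i : Fin t, τ (yg R t i) = xg R t i) {a b : Fin t → ℕ}
    (hab : ∀ i, a i + b i < 2) (h0 : (a, b) ≠ (0, 0)) :
    monXY R t a b + monXY R t b a ∈ squarefreeSpan τ := by
  have ha : ∀ i, a i < 2 := fun i => by have := hab i; omega
  have hb : ∀ i, b i < 2 := fun i => by have := hab i; omega
  by_cases ha0 : a = 0
  · have hb0 : b ≠ 0 := by rintro rfl; exact h0 (by rw [ha0])
    rw [ha0, monXY_zero_left, monXY_zero_right, add_comm]
    exact xpow_add_ypow_mem_squarefreeSpan hb hb0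
  by_cases hb0 : b = 0
  · rw [hb0, monXY_zero_left, monXY_zero_right]
    exact xpow_add_ypow_mem_squarefreeSpan ha ha0
  have hfix : τ (xpow R t a + ypow R t a) = xpow R t a + ypow R t a := by
    simp only [← monXY_zero_left, ← monXY_zero_right, map_add, map_monXY hτx hτy, add_comm]
  have hsum : xpow R t (a + b) + ypow R t (a + b) ∈ squarefreeSpan τ :=
    xpow_add_ypow_mem_squarefreeSpan hab fun h => ha0 (add_eq_zero.mp h).1
  convert sub_mem (mul_mem_squarefreeSpan hfix (xpow_add_ypow_mem_squarefreeSpan hb hb0)) hsum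
    using 1
  simp only [monXY_eq_mul, xpow_add, ypow_add]
  ring

lemma monXY_symm_mem_squarefreeSpan (hτx : ∀ i : Fin t, τ (xg R t i) = yg R t i)
    (hτy : ∀ i : Fin t, τ (yg R t i) = xg R t i) {a b : Fin t → ℕ} (h0 : (a, b) ≠ (0, 0)) :
    monXY R t a b + monXY R t b a ∈ squarefreeSpan τ := by
  by_cases hab : ∀ i, a i + b i < 2
  · exact monXY_symm_mem_of_squarefree hτx hτy hab h0
  push Not at hab
  obtain ⟨i, hi⟩ := hab
  by_cases ha : 2 ≤ a i
  · exact monXY_symm_mem_of_two_le hτx hτy b ha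
  by_cases hb : 2 ≤ b i
  · rw [add_comm]
    exact monXY_symm_mem_of_two_le hτx hτy a hb
  exact monXY_symm_mem_of_both_pos (i := i) hτx hτy (by omega) (by omega)

end

/-- For `λ, μ ∈ ℕ^t` with `(λ, μ) ≠ (0, 0)`, the element `x^λ y^μ + x^μ y^λ` is an
`A_+`-linear combination (coefficients fixed by `τ`) of the elements `x^γ + y^γ`,
`γ ∈ {0,1}^t − {0}`. -/
theorem stmt8 (R : Type*) [CommRing R] (t : ℕ) (ht : 1 ≤ t)
    (τ : QA R t ≃ₐ[R] QA R t)
    (hτx : ∀ i : Fin t, τ (xg R t i) = yg R t i)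
    (hτy : ∀ i : Fin t, τ (yg R t i) = xg R t i)
    (lam mu : Fin t → ℕ) (hlm : (lam, mu) ≠ (0, 0)) :
    ∃ c : (Fin t → Fin 2) → QA R t, (∀ γ, τ (c γ) = c γ) ∧
      monXY R t lam mu + monXY R t mu lam =
        ∑ γ ∈ Finset.univ.filter (fun γ : Fin t → Fin 2 => γ ≠ 0),
          c γ * (xpow R t (fun i => (γ i : ℕ)) + ypow R t (fun i => (γ i : ℕ))) := by
  obtain ⟨c, hc⟩ := (Submodule.mem_span_image_finset_iff_exists_fun' _).mp
    (monXY_symm_mem_squarefreeSpan hτx hτy hlm)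
  exact ⟨fun γ => c γ, fun γ => (c γ).2, hc.symm⟩
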